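/- Let τ : ℝ → ℝ³ be continuously differentiable with ‖τ(s)‖ = 1 for all s, and let b₁ : ℝ → ℝ³ be differentiable and satisfy the parallel-transport equation b₁′(s) = (τ(s) × τ′(s)) × b₁(s) for all s, with ‖b₁(0)‖ = 1 and ⟨b₁(0), τ(0)⟩ = 0. Then for every s: ‖b₁(s)‖ = 1, ⟨b₁(s), τ(s)⟩ = 0, and, setting b₂ = τ × b₁, the triple (b₁(s), b₂(s), τ(s)) is a right-handed orthonormal frame satisfying the twist-free condition ⟨b₂(s), b₁′(s)⟩ = 0; i.e., parallel transport produces a Bishop (twist-free) adapted frame. -/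

import Mathlib

open scoped RealInnerProductSpace

noncomputable section

/-- ℝ³ with the Euclidean inner product and norm. -/
abbrev E3 : Type := EuclideanSpace ℝ (Fin 3)

/-- The cross product on ℝ³. -/
def cross3 (u v : E3) : E3 :=
  !₂[u 1 * v 2 - u 2 * v 1, u 2 * v 0 - u 0 * v 2, u 0 * v 1 - u 1 * v 0]

/-- `(u, v, w)` is a right-handed orthonormal frame: all three are unit vectors,
pairwise orthogonal, and `u × v = w`. -/
def IsRHFrame (u v w : E3) : Prop :=
  ‖u‖ = 1 ∧ ‖v‖ = 1 ∧ ‖w‖ = 1 ∧ ⟪u, v⟫ = 0 ∧ ⟪u, w⟫ = 0 ∧ ⟪v, w⟫ = 0 ∧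
    cross3 u v = w

theorem inner3 (u v : E3) : ⟪u, v⟫ = u 0 * v 0 + u 1 * v 1 + u 2 * v 2 := by
  simp [PiLp.inner_apply, Fin.sum_univ_three]; ring

theorem norm3 (u : E3) : ‖u‖ = 1 ↔ u 0 * u 0 + u 1 * u 1 + u 2 * u 2 = 1 := by
  rw [← inner3, real_inner_self_eq_norm_sq]
  constructor
  · intro h; rw [h]; norm_num
  · intro h; nlinarith [norm_nonneg u]

theorem cross3_0 (u v : E3) : cross3 u v 0 = u 1 * v 2 - u 2 * v 1 := by simp [cross3]
theorem cross3_1 (u v : E3) : cross3 u v 1 = u 2 * v 0 - u 0 * v 2 := by simp [cross3]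
theorem cross3_2 (u v : E3) : cross3 u v 2 = u 0 * v 1 - u 1 * v 0 := by simp [cross3]

/-- Parallel transport along a unit-speed tangent field produces a Bishop (twist-free)
adapted frame: if `b₁′ = (τ × τ′) × b₁` with `b₁(0)` a unit vector orthogonal to `τ(0)`,
then `b₁(s)` stays a unit vector orthogonal to `τ(s)`, and with `b₂ = τ × b₁` the triple
`(b₁, b₂, τ)` is a right-handed orthonormal frame with `⟪b₂, b₁′⟫ = 0`. -/
theorem parallel_transport_gives_bishop_frame
    (τ : ℝ → E3) (hτ : ContDiff ℝ 1 τ) (hunit : ∀ s, ‖τ s‖ = 1)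
    (b₁ : ℝ → E3) (hb₁ : Differentiable ℝ b₁)
    (hode : ∀ s, deriv b₁ s = cross3 (cross3 (τ s) (deriv τ s)) (b₁ s))
    (hb₁0 : ‖b₁ 0‖ = 1) (horth0 : ⟪b₁ 0, τ 0⟫ = 0) :
    ∀ s, ‖b₁ s‖ = 1 ∧ ⟪b₁ s, τ s⟫ = 0 ∧
      IsRHFrame (b₁ s) (cross3 (τ s) (b₁ s)) (τ s) ∧
      ⟪cross3 (τ s) (b₁ s), deriv b₁ s⟫ = 0 := by
  have hτd : ∀ s, HasDerivAt τ (deriv τ s) s := fun s =>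
    ((hτ.differentiable (by norm_num)) s).hasDerivAt
  have hbd : ∀ s, HasDerivAt b₁ (deriv b₁ s) s := fun s => (hb₁ s).hasDerivAt
  have hττ : ∀ s, ⟪τ s, deriv τ s⟫ = 0 := by
    intro s
    have h := (hτd s).inner ℝ (hτd s)
    have hc : (fun t => ⟪τ t, τ t⟫) = fun _ => (1 : ℝ) := by
      funext t; rw [real_inner_self_eq_norm_sq, hunit]; norm_num
    rw [hc] at h
    have h2 := h.unique (hasDerivAt_const s (1 : ℝ))
    rw [real_inner_comm (τ s) (deriv τ s)] at h2
    linarith [real_inner_comm (τ s) (deriv τ s)]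
  have hbb : ∀ s, ⟪b₁ s, b₁ s⟫ = ⟪b₁ 0, b₁ 0⟫ := by
    intro s
    refine is_const_of_deriv_eq_zero (f := fun t => ⟪b₁ t, b₁ t⟫)
      (fun t => ((hbd t).inner ℝ (hbd t)).differentiableAt) (fun t => ?_) s 0
    rw [((hbd t).inner ℝ (hbd t)).deriv, hode]
    simp only [inner3, cross3_0, cross3_1, cross3_2]; ring
  have hbτ : ∀ s, ⟪b₁ s, τ s⟫ = ⟪b₁ 0, τ 0⟫ := by
    intro s
    refine is_const_of_deriv_eq_zero (f := fun t => ⟪b₁ t, τ t⟫)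
      (fun t => ((hbd t).inner ℝ (hτd t)).differentiableAt) (fun t => ?_) s 0
    rw [((hbd t).inner ℝ (hτd t)).deriv, hode]
    have h1 := hττ t
    have h2 := (norm3 _).1 (hunit t)
    simp only [inner3, cross3_0, cross3_1, cross3_2] at h1 ⊢
    linear_combination (b₁ t 0 * τ t 0 + b₁ t 1 * τ t 1 + b₁ t 2 * τ t 2) * h1
      - (b₁ t 0 * deriv τ t 0 + b₁ t 1 * deriv τ t 1 + b₁ t 2 * deriv τ t 2) * h2
  intro s
  have hn : ‖b₁ s‖ = 1 := by
    rw [norm3, ← inner3, hbb, inner3, ← norm3]; exact hb₁0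
  have ho : ⟪b₁ s, τ s⟫ = 0 := by rw [hbτ, horth0]
  have h1 := (norm3 _).1 hn
  have h2 := (norm3 _).1 (hunit s)
  have h3 := ho
  rw [inner3] at h3
  refine ⟨hn, ho, ⟨hn, ?_, hunit s, ?_, ho, ?_, ?_⟩, ?_⟩
  · rw [norm3]
    simp only [cross3_0, cross3_1, cross3_2]
    linear_combination (τ s 0 * τ s 0 + τ s 1 * τ s 1 + τ s 2 * τ s 2) * h1 + h2
      - (b₁ s 0 * τ s 0 + b₁ s 1 * τ s 1 + b₁ s 2 * τ s 2) * h3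
  · simp only [inner3, cross3_0, cross3_1, cross3_2]; ring
  · simp only [inner3, cross3_0, cross3_1, cross3_2]; ring
  · ext i
    fin_cases i
    · change cross3 _ _ 0 = τ s 0
      simp only [cross3_0, cross3_1, cross3_2]
      linear_combination τ s 0 * h1 - b₁ s 0 * h3
    · change cross3 _ _ 1 = τ s 1
      simp only [cross3_0, cross3_1, cross3_2]
      linear_combination τ s 1 * h1 - b₁ s 1 * h3
    · change cross3 _ _ 2 = τ s 2
      simp only [cross3_0, cross3_1, cross3_2]
      linear_combination τ s 2 * h1 - b₁ s 2 * h3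
  · rw [hode]
    simp only [inner3, cross3_0, cross3_1, cross3_2]
    linear_combination ((τ s 1 * b₁ s 2 - τ s 2 * b₁ s 1) * deriv τ s 0
      + (τ s 2 * b₁ s 0 - τ s 0 * b₁ s 2) * deriv τ s 1
      + (τ s 0 * b₁ s 1 - τ s 1 * b₁ s 0) * deriv τ s 2) * h3
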